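/- Let R be a nondegenerate self-concordant function on int(X) and x ∈ int(X). For every x' in the Dikin ellipsoid W(x) = {x' : ‖x' − x‖_x ≤ 1} (with r := ‖x' − x‖_x < 1), the Hessians satisfy (1 − r)²·∇²R(x) ⪯ ∇²R(x') ⪯ (1 − r)^{−2}·∇²R(x) in the positive semidefinite order. -/

import Mathlib

lemma szego (a b d e M : ℝ) (H : ∀ c s : ℝ, c^2+s^2=1 → |a*c^3+3*b*c^2*s+3*d*c*s^2+e*s^3| ≤ M)
   (C S : ℝ) (h : C^2+S^2=1) : |a*C+b*S| ≤ M := by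
  obtain ⟨φ, hC, hS⟩ : ∃ φ : ℝ, C = Real.cos φ ∧ S = Real.sin φ := by
    refine ⟨Complex.arg ⟨C,S⟩, ?_, ?_⟩
    · rw [Complex.cos_arg]
      · simp [Complex.norm_def, Complex.normSq_apply, ← sq, h]
      · intro h0
        rw [Complex.ext_iff] at h0
        simp at h0
        rw [h0.1, h0.2] at h; norm_num at h
    · simp [Complex.sin_arg, Complex.norm_def, Complex.normSq_apply, ← sq, h]
  obtain ⟨θ, rfl⟩ : ∃ θ, φ = 3*θ := ⟨φ/3, by ring⟩
  rw [Real.cos_three_mul] at hC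
  rw [Real.sin_three_mul] at hS
  have hcs := Real.cos_sq_add_sin_sq θ
  set c := Real.cos θ
  set s := Real.sin θ
  obtain ⟨q, hq⟩ : ∃ q : ℝ, q^2 = 3 := ⟨√3, by norm_num⟩
  have h0 := H c s hcs
  have h1 := H (-c/2 - q/2*s) (-s/2+q/2*c) (by linear_combination (1/4+q^2/4)*hcs + hq/4)
  have h2 := H (-c/2 + q/2*s) (-s/2-q/2*c) (by linear_combination (1/4+q^2/4)*hcs + hq/4)
  have key : ∀ P : ℝ → ℝ → ℝ, ∀ w0 w1 w2 : ℝ, 0 ≤ w0 → 0 ≤ w1 → 0 ≤ w2 → w0+w1+w2 = 1 → 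
    ∀ p0 p1 p2 : ℝ, |p0| ≤ M → |p1| ≤ M → |p2| ≤ M → |w0*p0+w1*p1+w2*p2| ≤ M := by
    intro P w0 w1 w2 g0 g1 g2 hw p0 p1 p2 k0 k1 k2
    rw [abs_le] at *
    have : M = w0*M+w1*M+w2*M := by rw [← add_mul, ← add_mul, hw, one_mul]
    constructor <;> nlinarith
  have := key (fun _ _ => 0) ((3*c^2-s^2)^2/9) ((3*(-c/2 - q/2*s)^2-(-s/2+q/2*c)^2)^2/9) ((3*(-c/2 + q/2*s)^2-(-s/2-q/2*c)^2)^2/9) (by positivity) (by positivity) (by positivity)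
    (by
      have q4 : q^4 = 9 := by rw [show q^4 = (q^2)^2 by ring, hq]; norm_num
      have e : (c^2+s^2)^2 = 1 := by rw [hcs]; norm_num
      ring_nf; simp only [q4, hq]; linear_combination e) _ _ _ h0 h1 h2
  convert this using 2
  rw [hC, hS]
  have q4 : q^4 = 9 := by rw [show q^4 = (q^2)^2 by ring, hq]; norm_num
  have q6 : q^6 = 27 := by rw [show q^6 = (q^2)^3 by ring, hq]; norm_num
  have e1 : 4*c^3-3*c = (4*c^3-3*c*(c^2+s^2))*(c^2+s^2)^2 := by rw [hcs]; ring
  have e2 : 3*s-4*s^3 = (3*s*(c^2+s^2)-4*s^3)*(c^2+s^2)^2 := by rw [hcs]; ring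
  rw [e1, e2]
  ring_nf; simp only [q4, q6, hq]; ring

lemma trilin {V : Type*} [AddCommGroup V] [Module ℝ V] (B : V → V → ℝ) (T : V → V → V → ℝ)
    (Ba : ∀ a b c, B (a+b) c = B a c + B b c) (Bm : ∀ (t : ℝ) a c, B (t • a) c = t * B a c)
    (Bs : ∀ a b, B a b = B b a) (Bp : ∀ a, a ≠ 0 → 0 < B a a)
    (Ta : ∀ a b c d, T (a+b) c d = T a c d + T b c d)
    (Tm : ∀ (t : ℝ) a c d, T (t • a) c d = t * T a c d)
    (T1 : ∀ a b c, T a b c = T b a c) (T2 : ∀ a b c, T a b c = T a c b)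
    (H : ∀ a, |T a a a| ≤ 2 * (B a a) ^ ((3:ℝ)/2)) (u h : V) :
    |T u h h| ≤ 2 * √(B u u) * B h h := by
  have Ba' : ∀ a b c, B c (a+b) = B c a + B c b := fun a b c => by
    rw [Bs, Ba, Bs a, Bs b]
  have Bm' : ∀ (t : ℝ) a c, B c (t • a) = t * B c a := fun t a c => by rw [Bs, Bm, Bs a]
  have Ta1 : ∀ a b c d, T c (a+b) d = T c a d + T c b d := fun a b c d => by
    rw [T1, Ta, T1 a, T1 b]
  have Ta2 : ∀ a b c d, T c d (a+b) = T c d a + T c d b := fun a b c d => by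
    rw [T2, Ta1, T2 _ a, T2 _ b]
  have Tm1 : ∀ (t : ℝ) a c d, T c (t • a) d = t * T c a d := fun t a c d => by
    rw [T1, Tm, T1 a]
  have Tm2 : ∀ (t : ℝ) a c d, T c d (t • a) = t * T c d a := fun t a c d => by
    rw [T2, Tm1, T2 _ a]
  have T0 : ∀ c d, T 0 c d = 0 := fun c d => by simpa using Tm 0 0 c d
  have B0 : ∀ c, B 0 c = 0 := fun c => by simpa using Bm 0 0 c
  by_cases hu : u = 0
  · subst hu; simp [T0, B0]
  by_cases hh : h = 0
  · subst hh; rw [T1]; simp [T0, B0]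
  have hhp := Bp h hh
  have hup := Bp u hu
  set p := √(B h h) with hp
  have pp : 0 < p := Real.sqrt_pos.2 hhp
  have p2 : p^2 = B h h := Real.sq_sqrt hhp.le
  set N := √(B u u) with hN
  have Np : 0 < N := Real.sqrt_pos.2 hup
  have N2 : N^2 = B u u := Real.sq_sqrt hup.le
  obtain ⟨e1, he1⟩ : ∃ e1, e1 = p⁻¹ • h := ⟨_, rfl⟩
  have hhe : h = p • e1 := by rw [he1, smul_smul, mul_inv_cancel₀ pp.ne', one_smul]
  have B11 : B e1 e1 = 1 := by
    rw [he1, Bm, Bm', ← p2]; field_simp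
  obtain ⟨C, hC⟩ : ∃ C, C = B u e1 := ⟨_, rfl⟩
  obtain ⟨k, hk⟩ : ∃ k, k = u + (-C) • e1 := ⟨_, rfl⟩
  have Bk1 : B k e1 = 0 := by rw [hk, Ba, Bm, B11, ← hC]; ring
  have Bkn : 0 ≤ B k k := by
    by_cases h0 : k = 0
    · rw [h0, B0]
    · exact (Bp k h0).le
  obtain ⟨S, hS⟩ : ∃ S, S = √(B k k) := ⟨_, rfl⟩
  have S2 : S^2 = B k k := by rw [hS]; exact Real.sq_sqrt Bkn
  have hS0 : S = 0 → k = 0 := by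
    intro h0
    by_contra hk0
    have := Bp k hk0
    rw [← S2, h0] at this; norm_num at this
  obtain ⟨e2, he2⟩ : ∃ e2, e2 = S⁻¹ • k := ⟨_, rfl⟩
  have hke : k = S • e2 := by
    by_cases h0 : S = 0
    · rw [h0, hS0 h0, zero_smul]
    · rw [he2, smul_smul, mul_inv_cancel₀ h0, one_smul]
  have B21 : B e2 e1 = 0 := by rw [he2, Bm, Bk1, mul_zero]
  have B22 : B e2 e2 ≤ 1 := by
    rw [he2, Bm, Bm', ← S2]
    by_cases h0 : S = 0
    · simp [h0]
    · apply le_of_eq; field_simp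
  have B22n : 0 ≤ B e2 e2 := by
    by_cases h0 : e2 = 0
    · rw [h0, B0]
    · exact (Bp _ h0).le
  have hue : u = C • e1 + S • e2 := by rw [← hke, hk]; module
  have hCS : C^2 + S^2 = N^2 := by
    rw [N2, S2]
    have e : B u u = B (C • e1 + k) (C • e1 + k) := by rw [hke, ← hue]
    rw [e, Ba, Ba', Ba', Bm, Bm, Bm', Bm', Bs e1 k, Bk1, B11]; ring
  have key := szego (T e1 e1 e1) (T e1 e1 e2) (T e1 e2 e2) (T e2 e2 e2) 2 (by
    intro c s hcs
    have h1 := H (c • e1 + s • e2)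
    have h2 : B (c • e1 + s • e2) (c • e1 + s • e2) = c^2 + s^2 * B e2 e2 := by
      simp only [Ba, Ba', Bm, Bm', Bs e1 e2, B21, B11]; ring
    have h3 : T (c • e1 + s • e2) (c • e1 + s • e2) (c • e1 + s • e2) =
        T e1 e1 e1*c^3+3*T e1 e1 e2*c^2*s+3*T e1 e2 e2*c*s^2+T e2 e2 e2*s^3 := by
      simp only [Ta, Ta1, Ta2, Tm, Tm1, Tm2]
      rw [T1 e2 e1 e1, T2 e1 e2 e1, T1 e2 e1 e2, T2 e2 e2 e1, T1 e2 e1 e2]; ring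
    rw [h2, h3] at h1
    refine h1.trans ?_
    have : (c^2 + s^2 * B e2 e2) ^ ((3:ℝ)/2) ≤ 1 := by
      apply Real.rpow_le_one (by positivity) _ (by norm_num)
      nlinarith [sq_nonneg s]
    linarith) (C/N) (S/N) (by rw [div_pow, div_pow, ← add_div, hCS]; field_simp)
  have e : T u h h = N * B h h * (T e1 e1 e1 * (C/N) + T e1 e1 e2 * (S/N)) := by
    rw [← p2]
    rw [hhe, Tm1, Tm2]
    nth_rewrite 1 [hue]
    rw [Ta, Tm, Tm, T1 e2, T2 e1 e2]
    field_simp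
  rw [e, abs_mul, abs_of_pos (by positivity)]
  have : 0 < N * B h h := by positivity
  nlinarith

lemma ode (f g f' g' : ℝ → ℝ) (hf : ∀ t ∈ Set.Icc (0:ℝ) 1, HasDerivAt f (f' t) t)
    (hg : ∀ t ∈ Set.Icc (0:ℝ) 1, HasDerivAt g (g' t) t)
    (f0 : ∀ t ∈ Set.Icc (0:ℝ) 1, 0 ≤ f t)
    (g0 : ∀ t ∈ Set.Icc (0:ℝ) 1, 0 < g t)
    (hf' : ∀ t ∈ Set.Icc (0:ℝ) 1, |f' t| ≤ 2 * √(g t) * f t)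
    (hg' : ∀ t ∈ Set.Icc (0:ℝ) 1, |g' t| ≤ 2 * √(g t) * g t)
    (r : ℝ) (hr : r = √(g 0)) (hr1 : r < 1) :
    (1 - r)^2 * f 0 ≤ f 1 ∧ f 1 ≤ ((1-r)⁻¹)^2 * f 0 := by
  have z0 : (0:ℝ) ∈ Set.Icc (0:ℝ) 1 := by simp
  have z1 : (1:ℝ) ∈ Set.Icc (0:ℝ) 1 := by simp
  have rp : 0 < r := hr ▸ Real.sqrt_pos.2 (g0 0 z0)
  have mono : ∀ F F' : ℝ → ℝ, (∀ t ∈ Set.Icc (0:ℝ) 1, HasDerivAt F (F' t) t) →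
      (∀ t ∈ Set.Icc (0:ℝ) 1, 0 ≤ F' t) → MonotoneOn F (Set.Icc 0 1) := by
    intro F F' h1 h2
    apply monotoneOn_of_hasDerivWithinAt_nonneg (f' := F') (convex_Icc 0 1)
      (fun t ht => (h1 t ht).continuousAt.continuousWithinAt)
      (fun t ht => (h1 t (interior_subset ht)).hasDerivWithinAt)
      (fun t ht => h2 t (interior_subset ht))
  have rt : ∀ t ∈ Set.Icc (0:ℝ) 1, 0 < 1 - r * t := by
    intro t ht; nlinarith [ht.1, ht.2]
  have gb : ∀ t ∈ Set.Icc (0:ℝ) 1, √(g t) * (1 - r*t) ≤ r := by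
    have := mono (fun t => (√(g t))⁻¹ + t) (fun t => -(g' t / (2*√(g t))) / (√(g t))^2 + 1)
      (fun t ht => (((hg t ht).sqrt (g0 t ht).ne').inv
        (Real.sqrt_pos.2 (g0 t ht)).ne').add (hasDerivAt_id t)) (by
        intro t ht
        have p := Real.sqrt_pos.2 (g0 t ht)
        have q := (abs_le.1 (hg' t ht)).2
        have q2 := Real.sq_sqrt (g0 t ht).le
        have : g' t / (2*√(g t)) / (√(g t))^2 ≤ 1 := by
          rw [div_div, div_le_one (by positivity), q2]; exact q
        rw [neg_div]; linarith)
    intro t ht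
    have h1 := this z0 ht ht.1
    simp only [← hr, add_zero] at h1
    have p := Real.sqrt_pos.2 (g0 t ht)
    have h2 := mul_le_mul_of_nonneg_left h1 (mul_pos p rp).le
    have e1 : √(g t) * r * r⁻¹ = √(g t) := by field_simp
    have e2 : √(g t) * r * ((√(g t))⁻¹ + t) = r + √(g t) * (r * t) := by field_simp
    rw [e1, e2] at h2
    linarith
  have hd : ∀ t : ℝ, HasDerivAt (fun t => 1 - r*t) (-r) t := by
    intro t; simpa using ((hasDerivAt_id t).const_mul r).const_sub 1
  constructor
  · have := mono (fun t => f t / (1-r*t)^2)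
      (fun t => (f' t * (1-r*t)^2 - f t * (2 * (1-r*t) * (-r))) / ((1-r*t)^2)^2)
      (fun t ht => by
        have h2 : HasDerivAt (fun t => (1-r*t)^2) (2*(1-r*t)*(-r)) t := by
          simpa using (hd t).fun_pow 2
        exact (hf t ht).fun_div h2 (by have := rt t ht; positivity)) (by
        intro t ht
        have h1 := rt t ht
        apply div_nonneg _ (by positivity)
        have h2 := (abs_le.1 (hf' t ht)).1
        have h3 := gb t ht
        have h4 := f0 t ht
        have : f' t * (1-r*t)^2 - f t * (2 * (1-r*t) * (-r)) =
          (f' t + 2 * √(g t) * f t) * (1-r*t)^2 + 2 * (f t * (1-r*t)) * (r - √(g t) * (1-r*t)) := by ring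
        rw [this]
        have : 0 ≤ f' t + 2 * √(g t) * f t := by linarith
        have : 0 ≤ r - √(g t) * (1-r*t) := by linarith
        positivity)
    have h1 := this z0 z1 zero_le_one
    simp only [mul_zero, mul_one, sub_zero, one_pow, div_one] at h1
    rw [le_div_iff₀ (by have : 0 < 1 - r := by linarith
                        positivity)] at h1
    linarith
  · have := mono (fun t => -(f t * (1-r*t)^2))
      (fun t => -(f' t * (1-r*t)^2 + f t * (2 * (1-r*t) * (-r))))
      (fun t ht => by
        have h2 : HasDerivAt (fun t => (1-r*t)^2) (2*(1-r*t)*(-r)) t := by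
          simpa using (hd t).fun_pow 2
        exact ((hf t ht).fun_mul h2).fun_neg) (by
        intro t ht
        have h1 := rt t ht
        have h2 := (abs_le.1 (hf' t ht)).2
        have h3 := gb t ht
        have h4 := f0 t ht
        have : -(f' t * (1-r*t)^2 + f t * (2 * (1-r*t) * (-r))) =
          (2 * √(g t) * f t - f' t) * (1-r*t)^2 + 2 * (f t * (1-r*t)) * (r - √(g t) * (1-r*t)) := by ring
        rw [this]
        have : 0 ≤ 2 * √(g t) * f t - f' t := by linarith
        have : 0 ≤ r - √(g t) * (1-r*t) := by linarith
        positivity)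
    have h1 := this z0 z1 zero_le_one
    simp only [mul_zero, mul_one, sub_zero, one_pow] at h1
    have : 0 < 1 - r := by linarith
    rw [inv_pow, inv_mul_eq_div, le_div_iff₀ (by positivity)]
    linarith

/-- Hessian stability on the Dikin ellipsoid: for a nondegenerate self-concordant `R` and
`x'` with `r = ‖x' − x‖_x < 1`, one has
`(1 − r)² ∇²R(x) ⪯ ∇²R(x') ⪯ (1 − r)⁻² ∇²R(x)` (as quadratic forms). -/
theorem dikin_hessian_bounds
    (n : ℕ) (s : Set (EuclideanSpace ℝ (Fin n))) (hs_open : IsOpen s) (hs_conv : Convex ℝ s)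
    (R : EuclideanSpace ℝ (Fin n) → ℝ)
    (hR_C3 : ContDiffOn ℝ 3 R s)
    -- nondegeneracy: positive definite Hessian
    (hR_pd : ∀ y ∈ s, ∀ h : EuclideanSpace ℝ (Fin n), h ≠ 0 →
      0 < iteratedFDerivWithin ℝ 2 R s y ![h, h])
    -- self-concordance
    (hR_sc : ∀ y ∈ s, ∀ h : EuclideanSpace ℝ (Fin n),
      |iteratedFDerivWithin ℝ 3 R s y ![h, h, h]| ≤
        2 * (iteratedFDerivWithin ℝ 2 R s y ![h, h]) ^ ((3 : ℝ) / 2))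
    (x : EuclideanSpace ℝ (Fin n)) (hx : x ∈ s)
    (x' : EuclideanSpace ℝ (Fin n)) (hx' : x' ∈ s)
    (r : ℝ)
    -- `r = ‖x' − x‖_x`, the local norm at `x`
    (hr : r = Real.sqrt (iteratedFDerivWithin ℝ 2 R s x ![x' - x, x' - x]))
    (hr1 : r < 1) :
    ∀ h : EuclideanSpace ℝ (Fin n),
      (1 - r) ^ 2 * iteratedFDerivWithin ℝ 2 R s x ![h, h] ≤
          iteratedFDerivWithin ℝ 2 R s x' ![h, h] ∧
        iteratedFDerivWithin ℝ 2 R s x' ![h, h] ≤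
          ((1 - r)⁻¹) ^ 2 * iteratedFDerivWithin ℝ 2 R s x ![h, h] := by
  have hsu : UniqueDiffOn ℝ s := hs_open.uniqueDiffOn
  have hcl : ∀ y ∈ s, y ∈ closure (interior s) := fun y hy => by
    rw [hs_open.interior_eq]; exact subset_closure hy
  have Bs : ∀ y ∈ s, ∀ a b, iteratedFDerivWithin ℝ 2 R s y ![a, b] =
      iteratedFDerivWithin ℝ 2 R s y ![b, a] := by
    intro y hy a b
    exact IsSymmSndFDerivWithinAt.iteratedFDerivWithin_cons
      (hf := (hR_C3 y hy).isSymmSndFDerivWithinAt (by simp; norm_num) hsu (hcl y hy) hy) hsu hy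
  have hD : ∀ y ∈ s, HasFDerivAt (iteratedFDerivWithin ℝ 2 R s)
      (fderivWithin ℝ (iteratedFDerivWithin ℝ 2 R s) s y) y := by
    intro y hy
    have h1 := hR_C3.differentiableOn_iteratedFDerivWithin (m := 2) (by norm_num) hsu y hy
    exact h1.hasFDerivWithinAt.hasFDerivAt (hs_open.mem_nhds hy)
  have hline : ∀ y ∈ s, ∀ u a b, HasDerivAt
      (fun t : ℝ => iteratedFDerivWithin ℝ 2 R s (y + t • u) ![a, b])
      (iteratedFDerivWithin ℝ 3 R s y ![u, a, b]) 0 := by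
    intro y hy u a b
    have hl : HasDerivAt (fun t : ℝ => y + t • u) u 0 := by
      simpa using ((hasDerivAt_id (0:ℝ)).smul_const u).const_add y
    have h1 := (hD y hy).comp_hasDerivAt_of_eq (0:ℝ) hl (by simp)
    have h2 := ((ContinuousMultilinearMap.apply ℝ (fun _ : Fin 2 => EuclideanSpace ℝ (Fin n)) ℝ
      ![a, b]).hasFDerivAt).comp_hasDerivAt (0:ℝ) h1
    exact h2
  have T2 : ∀ y ∈ s, ∀ a b c, iteratedFDerivWithin ℝ 3 R s y ![a, b, c] =
      iteratedFDerivWithin ℝ 3 R s y ![a, c, b] := by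
    intro y hy a b c
    have h1 := hline y hy a b c
    have h2 := hline y hy a c b
    refine h1.unique (h2.congr_of_eventuallyEq ?_)
    have hc : ContinuousAt (fun t : ℝ => y + t • a) 0 := by fun_prop
    have := hc.preimage_mem_nhds (t := s) (hs_open.mem_nhds (by simpa using hy))
    filter_upwards [this] with t ht
    exact Bs _ ht b c
  have T1 : ∀ y ∈ s, ∀ a b c, iteratedFDerivWithin ℝ 3 R s y ![a, b, c] =
      iteratedFDerivWithin ℝ 3 R s y ![b, a, c] := by
    intro y hy a b c
    have hC2 : ContDiffOn ℝ 2 (fun y => fderivWithin ℝ R s y) s :=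
      hR_C3.fderivWithin hsu (by norm_num)
    have h1 := IsSymmSndFDerivWithinAt.iteratedFDerivWithin_cons (v := a) (w := b)
      (hf := (hC2 y hy).isSymmSndFDerivWithinAt (by simp) hsu (hcl y hy) hy) hsu hy
    have e : ∀ a b : EuclideanSpace ℝ (Fin n), Fin.init ![a, b, c] = ![a, b] := by
      intro a b; ext i : 1; fin_cases i <;> rfl
    have e3 : ∀ a b : EuclideanSpace ℝ (Fin n), iteratedFDerivWithin ℝ 3 R s y ![a, b, c] =
        iteratedFDerivWithin ℝ 2 (fun y => fderivWithin ℝ R s y) s y ![a, b] c := by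
      intro a b
      rw [iteratedFDerivWithin_succ_apply_right (n := 2) hsu hy, e]
      rfl
    rw [e3, e3, h1]
  have tri : ∀ y ∈ s, ∀ u h, |iteratedFDerivWithin ℝ 3 R s y ![u, h, h]| ≤
      2 * √(iteratedFDerivWithin ℝ 2 R s y ![u, u]) * iteratedFDerivWithin ℝ 2 R s y ![h, h] := by
    intro y hy u h
    exact trilin (fun a b => iteratedFDerivWithin ℝ 2 R s y ![a, b])
      (fun a b c => iteratedFDerivWithin ℝ 3 R s y ![a, b, c])
      (fun a b c => (iteratedFDerivWithin ℝ 2 R s y).cons_add ![c] a b)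
      (fun t a c => (iteratedFDerivWithin ℝ 2 R s y).cons_smul ![c] t a)
      (Bs y hy) (hR_pd y hy)
      (fun a b c d => (iteratedFDerivWithin ℝ 3 R s y).cons_add ![c, d] a b)
      (fun t a c d => (iteratedFDerivWithin ℝ 3 R s y).cons_smul ![c, d] t a)
      (T1 y hy) (T2 y hy) (hR_sc y hy) u h
  intro h
  have nn : ∀ y ∈ s, ∀ h, 0 ≤ iteratedFDerivWithin ℝ 2 R s y ![h, h] := by
    intro y hy h
    by_cases h0 : h = 0
    · apply le_of_eq
      symm
      exact (iteratedFDerivWithin ℝ 2 R s y).map_coord_zero 0 (by simp [h0])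
    · exact (hR_pd y hy h h0).le
  by_cases hu : x' - x = 0
  · have hxx : x' = x := sub_eq_zero.1 hu
    have r0 : r = 0 := by
      rw [hr, hu, (iteratedFDerivWithin ℝ 2 R s x).map_coord_zero 0 (by simp), Real.sqrt_zero]
    rw [r0, hxx]; simp
  have hmem : ∀ t ∈ Set.Icc (0:ℝ) 1, x + t • (x' - x) ∈ s :=
    fun t ht => hs_conv.add_smul_sub_mem hx hx' ht
  have hder : ∀ a, ∀ t ∈ Set.Icc (0:ℝ) 1, HasDerivAt
      (fun t : ℝ => iteratedFDerivWithin ℝ 2 R s (x + t • (x' - x)) ![a, a])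
      (iteratedFDerivWithin ℝ 3 R s (x + t • (x' - x)) ![x' - x, a, a]) t := by
    intro a t ht
    have h1 := hline _ (hmem t ht) (x' - x) a a
    have h2 : HasDerivAt (fun τ : ℝ => τ - t) 1 t := by
      simpa using (hasDerivAt_id t).sub_const t
    have h3 := h1.comp_of_eq t h2 (by simp)
    rw [mul_one] at h3
    refine h3.congr_of_eventuallyEq (Filter.Eventually.of_forall fun τ => ?_)
    have e : x + τ • (x' - x) = x + t • (x' - x) + (τ - t) • (x' - x) := by module
    simp only [Function.comp, e]
  have := ode (fun t => iteratedFDerivWithin ℝ 2 R s (x + t • (x' - x)) ![h, h])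
    (fun t => iteratedFDerivWithin ℝ 2 R s (x + t • (x' - x)) ![x' - x, x' - x]) _ _
    (hder h) (hder (x' - x)) (fun t ht => nn _ (hmem t ht) h)
    (fun t ht => hR_pd _ (hmem t ht) _ hu)
    (fun t ht => tri _ (hmem t ht) _ _) (fun t ht => tri _ (hmem t ht) _ _) r
    (by simpa using hr) hr1
  simpa using this
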